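/- arXiv:2508.20855 — 2 statements merged into one kernel-verified Lean document; each statement's English description precedes it below -/
import Mathlib

section
/- Let T ≥ 2. With G_T = Δ_T(1,2,-1), M_T = 2·D⁺_{u,T}(G_T ⊗ G_T)(D⁺_{u,T})′, p_T = T(T+1)/2 − 2, g_T the p_T-vector defined by vech(G_T) = (1, −1, g_T′)′, P_T = (0 | g_T | I_{p_T}), R_T = P_T·M_T·P_T′, and w_T the p_T-vector defined by vech(I_T) = (1, 0, w_T′)′, the matrix R_T is invertible and w_T′·R_T⁻¹·w_T = (2T−1)(T+1)T(T−1)/72. -/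
open Matrix
open scoped Matrix Kronecker

noncomputable section

/-- `tri n a b c` is the n×n tridiagonal matrix with (1,1) entry `a`, all other
diagonal entries `b`, all super- and sub-diagonal entries `c`, and zeros elsewhere. -/
def tri (n : ℕ) (a b c : ℝ) : Matrix (Fin n) (Fin n) ℝ :=
  Matrix.of fun i j =>
    if (i : ℕ) = (j : ℕ) then (if (i : ℕ) = 0 then a else b)
    else if (i : ℕ) + 1 = (j : ℕ) ∨ (j : ℕ) + 1 = (i : ℕ) then c else 0

/-- Index set for `vech`: pairs (column j, row i) with j ≤ i, i.e. on-and-below-diagonal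
positions, the order of the stacking being column-major. -/
abbrev VechIdx (T : ℕ) : Type := {p : Fin T × Fin T // (p.1 : ℕ) ≤ (p.2 : ℕ)}

/-- column-major vec: `vecM A (j, i) = A i j`. -/
def vecM {T : ℕ} (A : Matrix (Fin T) (Fin T) ℝ) : Fin T × Fin T → ℝ :=
  fun p => A p.2 p.1

/-- half-vectorization: entries on and below the diagonal, column by column. -/
def vechM {T : ℕ} (A : Matrix (Fin T) (Fin T) ℝ) : VechIdx T → ℝ :=
  fun q => A q.val.2 q.val.1

/-- the duplication matrix: the unique matrix with `vecM A = dup T *ᵥ vechM A`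
for every symmetric T×T matrix A. -/
def dup (T : ℕ) : Matrix (Fin T × Fin T) (VechIdx T) ℝ :=
  Matrix.of fun p q =>
    if (p.1 = q.val.1 ∧ p.2 = q.val.2) ∨ (p.1 = q.val.2 ∧ p.2 = q.val.1) then 1 else 0

/-- Moore–Penrose inverse of the duplication matrix. -/
def dupPlus (T : ℕ) : Matrix (VechIdx T) (Fin T × Fin T) ℝ :=
  ((dup T)ᵀ * dup T)⁻¹ * (dup T)ᵀ

/-- M_T = 2 D⁺ (G ⊗ G) D⁺′ with G the tridiagonal Δ_T(1,2,-1). -/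
def MMat (T : ℕ) : Matrix (VechIdx T) (VechIdx T) ℝ :=
  (2 : ℝ) • (dupPlus T * (tri T 1 2 (-1) ⊗ₖ tri T 1 2 (-1)) * (dupPlus T)ᵀ)

/-- Index set of the "remaining" vech entries (all but the first two in column-major order). -/
abbrev RIdx (T : ℕ) : Type :=
  {q : VechIdx T // ¬((q.val.1 : ℕ) = 0 ∧ (q.val.2 : ℕ) = 0) ∧
                   ¬((q.val.1 : ℕ) = 0 ∧ (q.val.2 : ℕ) = 1)}

/-- g_T : the vector with vech(G_T) = (1, −1, g_T′)′. -/
def gVec (T : ℕ) : RIdx T → ℝ := fun q => vechM (tri T 1 2 (-1)) q.val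

/-- P_T = (0 | g_T | I_{p_T}). -/
def PMat (T : ℕ) : Matrix (RIdx T) (VechIdx T) ℝ :=
  Matrix.of fun r c =>
    if (c.val.1 : ℕ) = 0 ∧ (c.val.2 : ℕ) = 0 then 0
    else if (c.val.1 : ℕ) = 0 ∧ (c.val.2 : ℕ) = 1 then gVec T r
    else if c = r.val then 1 else 0

/-- Z_T : 2 × T(T+1)/2 matrix with rows (1,0,0,…,0) and (0,1,−g_T′). -/
def ZMat (T : ℕ) : Matrix (Fin 2) (VechIdx T) ℝ :=
  Matrix.of fun i c =>
    if (i : ℕ) = 0 then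
      (if (c.val.1 : ℕ) = 0 ∧ (c.val.2 : ℕ) = 0 then 1 else 0)
    else
      (if (c.val.1 : ℕ) = 0 ∧ (c.val.2 : ℕ) = 0 then 0
       else if (c.val.1 : ℕ) = 0 ∧ (c.val.2 : ℕ) = 1 then 1
       else -(vechM (tri T 1 2 (-1)) c))

/-- w_T : the vector with vech(I_T) = (1, 0, w_T′)′. -/
def wVec (T : ℕ) : RIdx T → ℝ := fun q => vechM (1 : Matrix (Fin T) (Fin T) ℝ) q.val

/-- R_T = P_T M_T P_T′. -/
def RMat (T : ℕ) : Matrix (RIdx T) (RIdx T) ℝ := PMat T * MMat T * (PMat T)ᵀ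

/-- The matrix with entries `T - max i j`, the inverse of `tri T 1 2 (-1)`. -/
def maxMat (T : ℕ) : Matrix (Fin T) (Fin T) ℝ :=
  Matrix.of fun i j => (T : ℝ) - ((max (i : ℕ) (j : ℕ) : ℕ) : ℝ)

lemma tri_transpose (T : ℕ) (a b c : ℝ) : (tri T a b c)ᵀ = tri T a b c := by
  ext i j
  simp only [transpose_apply, tri, of_apply]
  grind

lemma maxMat_transpose (T : ℕ) : (maxMat T)ᵀ = maxMat T := by
  ext i j
  simp [maxMat, max_comm]

lemma sum_tri_mul {T : ℕ} (i : Fin T) (f : ℕ → ℝ) (hf : f T = 0) :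
    ∑ j : Fin T, tri T 1 2 (-1) i j * f j =
      (if (i : ℕ) = 0 then f i else 2 * f i - f (i - 1)) - f (i + 1) := by
  have key : ∀ j : Fin T, tri T 1 2 (-1) i j * f j =
      (if (j : ℕ) = i then (if (i : ℕ) = 0 then 1 else 2) * f i else 0)
      - (if (j : ℕ) = i + 1 then f (i + 1) else 0)
      - (if (j : ℕ) = i - 1 then (if (i : ℕ) = 0 then 0 else f (i - 1)) else 0) := by
    intro j
    simp only [tri, of_apply]
    grind
  simp_rw [key]
  rw [Fin.sum_univ_eq_sum_range (fun j : ℕ =>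
      (if j = i then (if (i : ℕ) = 0 then 1 else 2) * f i else 0)
      - (if j = (i : ℕ) + 1 then f (i + 1) else 0)
      - (if j = (i : ℕ) - 1 then (if (i : ℕ) = 0 then 0 else f (i - 1)) else 0)) T,
    Finset.sum_sub_distrib, Finset.sum_sub_distrib, Finset.sum_ite_eq', Finset.sum_ite_eq',
    Finset.sum_ite_eq']
  have := i.isLt
  have h : f (i + 1) = if (i : ℕ) + 1 < T then f (i + 1) else 0 := by
    split_ifs
    · rfl
    · rw [← hf]; congr 1; omega
  simp only [Finset.mem_range]
  grind

lemma tri_mul_maxMat (T : ℕ) : tri T 1 2 (-1) * maxMat T = 1 := by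
  ext i l
  have hl := l.isLt
  have h := sum_tri_mul i (fun j => (T : ℝ) - ((max j (l : ℕ) : ℕ) : ℝ)) (by
    rw [max_eq_left hl.le, sub_self])
  simp only [mul_apply, maxMat, of_apply, one_apply, Fin.ext_iff]
  rw [h]
  rcases lt_trichotomy (i : ℕ) l with h1 | h1 | h1
  · rw [if_neg h1.ne, max_eq_right h1.le, max_eq_right (by omega : (i : ℕ) - 1 ≤ l),
      max_eq_right (by omega : (i : ℕ) + 1 ≤ l)]
    split_ifs <;> ring
  · rw [if_pos h1, max_eq_right h1.le, max_eq_right (by omega : (i : ℕ) - 1 ≤ l),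
      max_eq_left (by omega : (l : ℕ) ≤ i + 1), h1]
    push_cast
    split_ifs <;> ring
  · rw [if_neg h1.ne', max_eq_left h1.le, max_eq_left (by omega : (l : ℕ) ≤ i - 1),
      max_eq_left (by omega : (l : ℕ) ≤ i + 1), if_neg (by omega),
      Nat.cast_sub (by omega : 1 ≤ (i : ℕ))]
    push_cast
    ring

lemma maxMat_mul_tri (T : ℕ) : maxMat T * tri T 1 2 (-1) = 1 :=
  mul_eq_one_comm.mp (tri_mul_maxMat T)

lemma maxMat_posSemidef (T : ℕ) : (maxMat T).PosSemidef := by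
  have h : maxMat T = (Matrix.of fun i k : Fin T => if i ≤ k then (1 : ℝ) else 0) *
      (Matrix.of fun i k : Fin T => if i ≤ k then (1 : ℝ) else 0)ᴴ := by
    ext i j
    have hc : ((T - max (i : ℕ) j : ℕ) : ℝ) = ((Finset.Ici (max i j)).card : ℝ) := by
      rw [Fin.card_Ici]
      congr 2
    have hf : Finset.Ici (max i j) = Finset.univ.filter fun k => i ≤ k ∧ j ≤ k := by
      ext k; simp
    rw [Nat.cast_sub (by omega)] at hc
    simp only [maxMat, of_apply, mul_apply, conjTranspose_apply, star_trivial]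
    rw [hc, hf, Finset.card_filter]
    push_cast
    refine Finset.sum_congr rfl fun k _ => ?_
    by_cases h1 : i ≤ k <;> by_cases h2 : j ≤ k <;> simp [h1, h2]
  rw [h]
  exact posSemidef_self_mul_conjTranspose _

lemma tri_posDef (T : ℕ) : (tri T 1 2 (-1)).PosDef := by
  have hK : (maxMat T).PosDef := (maxMat_posSemidef T).posDef_iff_isUnit.mpr
    (IsUnit.of_mul_eq_one _ (maxMat_mul_tri T))
  rw [← inv_eq_right_inv (maxMat_mul_tri T)]
  exact hK.inv

lemma dup_mulVec_apply {T : ℕ} (x : VechIdx T → ℝ) (q : VechIdx T) :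
    (dup T *ᵥ x) q.val = x q := by
  have key : ∀ c : VechIdx T, dup T q.val c * x c = if c = q then x q else 0 := by
    rintro ⟨⟨a, b⟩, h⟩
    obtain ⟨⟨c, d⟩, h'⟩ := q
    simp only [dup, of_apply, Subtype.mk.injEq, Prod.mk.injEq]
    grind
  simp [mulVec, dotProduct, key]

lemma dup_mulVec_apply_swap {T : ℕ} (x : VechIdx T → ℝ) (q : VechIdx T) :
    (dup T *ᵥ x) q.val.swap = x q := by
  rw [← dup_mulVec_apply x q]
  simp only [mulVec, dotProduct]
  refine Finset.sum_congr rfl fun c _ => ?_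
  congr 1
  simp only [dup, of_apply, Prod.fst_swap, Prod.snd_swap]
  grind

lemma dup_mulVec_vechM {T : ℕ} {A : Matrix (Fin T) (Fin T) ℝ} (hA : Aᵀ = A) :
    dup T *ᵥ vechM A = vecM A := by
  ext ⟨i, j⟩
  rcases le_total (i : ℕ) j with h | h
  · exact dup_mulVec_apply (vechM A) ⟨(i, j), h⟩
  · refine (dup_mulVec_apply_swap (vechM A) ⟨(j, i), h⟩).trans ?_
    exact congrFun (congrFun hA j) i

lemma isUnit_dup_gram (T : ℕ) : IsUnit ((dup T)ᵀ * dup T) := by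
  rw [← conjTranspose_eq_transpose_of_trivial]
  refine (PosDef.conjTranspose_mul_self _ fun x y h => ?_).isUnit
  ext q
  rw [← dup_mulVec_apply x q, ← dup_mulVec_apply y q]
  exact congrFun h q.val

lemma dupPlus_mul_dup (T : ℕ) : dupPlus T * dup T = 1 := by
  rw [dupPlus, Matrix.mul_assoc]
  exact nonsing_inv_mul _ ((isUnit_iff_isUnit_det _).mp (isUnit_dup_gram T))

lemma dup_transpose_mul_dupPlus_transpose (T : ℕ) : (dup T)ᵀ * (dupPlus T)ᵀ = 1 := by
  rw [← transpose_mul, dupPlus_mul_dup, transpose_one]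

lemma dupPlus_transpose_mul_gram (T : ℕ) :
    (dupPlus T)ᵀ * ((dup T)ᵀ * dup T) = dup T := by
  have hs : ((dup T)ᵀ * dup T)ᵀ = (dup T)ᵀ * dup T := by
    rw [transpose_mul, transpose_transpose]
  rw [dupPlus, transpose_mul, transpose_nonsing_inv, hs, transpose_transpose, Matrix.mul_assoc,
    nonsing_inv_mul _ ((isUnit_iff_isUnit_det _).mp (isUnit_dup_gram T)), Matrix.mul_one]

lemma vecMul_injective_of_mul_eq_one {m n : Type*} [Fintype m] [Fintype n] [DecidableEq m]
    {A : Matrix m n ℝ} {B : Matrix n m ℝ} (h : A * B = 1) :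
    Function.Injective A.vecMul := fun x y hxy => by
  have := congrArg (· ᵥ* B) hxy
  simpa [vecMul_vecMul, h] using this

lemma MMat_posDef (T : ℕ) : (MMat T).PosDef := by
  refine PosDef.smul ?_ two_pos
  rw [← conjTranspose_eq_transpose_of_trivial]
  exact ((tri_posDef T).kronecker (tri_posDef T)).mul_mul_conjTranspose_same
    (vecMul_injective_of_mul_eq_one (dupPlus_mul_dup T))

lemma MMat_mulVec {T : ℕ} {S : Matrix (Fin T) (Fin T) ℝ} (hS : Sᵀ = S) :
    MMat T *ᵥ ((1 / 2 : ℝ) • ((dup T)ᵀ *ᵥ vecM S)) =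
      vechM (tri T 1 2 (-1) * S * tri T 1 2 (-1)) := by
  have h1 : (dupPlus T)ᵀ *ᵥ ((dup T)ᵀ *ᵥ vecM S) = vecM S := by
    rw [← dup_mulVec_vechM hS, mulVec_mulVec, mulVec_mulVec, Matrix.mul_assoc,
      dupPlus_transpose_mul_gram]
  have h2 : (tri T 1 2 (-1) ⊗ₖ tri T 1 2 (-1)) *ᵥ vecM S =
      vecM (tri T 1 2 (-1) * S * tri T 1 2 (-1)) := by
    refine (kronecker_mulVec_vec _ _ _).trans ?_
    rw [tri_transpose]
    rfl
  have h3 : (tri T 1 2 (-1) * S * tri T 1 2 (-1))ᵀ = tri T 1 2 (-1) * S * tri T 1 2 (-1) := by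
    rw [transpose_mul, transpose_mul, hS, tri_transpose, Matrix.mul_assoc]
  rw [MMat, mulVec_smul, smul_mulVec, smul_smul, ← mulVec_mulVec, ← mulVec_mulVec, h1, h2,
    ← dup_mulVec_vechM h3, mulVec_mulVec, dupPlus_mul_dup, one_mulVec]
  norm_num

lemma vechM_dotProduct {T : ℕ} {A : Matrix (Fin T) (Fin T) ℝ} (hA : Aᵀ = A)
    (S : Matrix (Fin T) (Fin T) ℝ) :
    vechM A ⬝ᵥ ((dup T)ᵀ *ᵥ vecM S) = (A * S).trace := by
  rw [dotProduct_mulVec, vecMul_transpose, dup_mulVec_vechM hA]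
  conv_rhs => rw [← hA]
  exact vec_dotProduct_vec A S

/-- The first index in column-major order. -/
def vechZero {T : ℕ} (hT : 2 ≤ T) : VechIdx T :=
  ⟨(⟨0, by omega⟩, ⟨0, by omega⟩), le_rfl⟩

/-- The second index in column-major order. -/
def vechOne {T : ℕ} (hT : 2 ≤ T) : VechIdx T :=
  ⟨(⟨0, by omega⟩, ⟨1, by omega⟩), Nat.zero_le _⟩

lemma eq_vechZero {T : ℕ} (hT : 2 ≤ T) {c : VechIdx T} (h : (c.val.1 : ℕ) = 0 ∧ (c.val.2 : ℕ) = 0) :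
    c = vechZero hT :=
  Subtype.ext (Prod.ext (Fin.ext h.1) (Fin.ext h.2))

lemma eq_vechOne {T : ℕ} (hT : 2 ≤ T) {c : VechIdx T} (h : (c.val.1 : ℕ) = 0 ∧ (c.val.2 : ℕ) = 1) :
    c = vechOne hT :=
  Subtype.ext (Prod.ext (Fin.ext h.1) (Fin.ext h.2))

lemma sum_vechIdx {T : ℕ} (hT : 2 ≤ T) (f : VechIdx T → ℝ) :
    ∑ c, f c = f (vechZero hT) + f (vechOne hT) + ∑ r : RIdx T, f r.val := by
  have hne : vechZero hT ≠ vechOne hT := by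
    intro h
    have := congrArg (fun c : VechIdx T => (c.val.2 : ℕ)) h
    simp [vechZero, vechOne] at this
  rw [← Finset.sum_pair hne, ← Finset.sum_add_sum_compl {vechZero hT, vechOne hT} f]
  congr 1
  refine Finset.sum_subtype _ (fun c => ?_) f
  rw [Finset.mem_compl, Finset.mem_insert, Finset.mem_singleton, not_or]
  refine and_congr (not_congr ⟨?_, eq_vechZero hT⟩) (not_congr ⟨?_, eq_vechOne hT⟩)
  · rintro rfl; exact ⟨rfl, rfl⟩
  · rintro rfl; exact ⟨rfl, rfl⟩

lemma PMat_vechZero {T : ℕ} (hT : 2 ≤ T) (r : RIdx T) : PMat T r (vechZero hT) = 0 := by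
  simp [PMat, vechZero]

lemma PMat_vechOne {T : ℕ} (hT : 2 ≤ T) (r : RIdx T) : PMat T r (vechOne hT) = gVec T r := by
  simp [PMat, vechOne]

lemma PMat_val {T : ℕ} (r s : RIdx T) : PMat T r s.val = if s = r then 1 else 0 := by
  simp only [PMat, of_apply, if_neg s.2.1, if_neg s.2.2, Subtype.ext_iff]

lemma PMat_mulVec {T : ℕ} (hT : 2 ≤ T) (x : VechIdx T → ℝ) (r : RIdx T) :
    (PMat T *ᵥ x) r = gVec T r * x (vechOne hT) + x r.val := by
  simp [mulVec, dotProduct, sum_vechIdx hT, PMat_vechZero, PMat_vechOne, PMat_val]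

lemma PMat_vecMul_injective (T : ℕ) : Function.Injective (PMat T).vecMul := by
  intro x y h
  ext r
  have := congrFun h r.val
  simpa [vecMul, dotProduct, PMat_val] using this

lemma RMat_isUnit (T : ℕ) : IsUnit (RMat T) := by
  rw [RMat, ← conjTranspose_eq_transpose_of_trivial]
  exact ((MMat_posDef T).mul_mul_conjTranspose_same (PMat_vecMul_injective T)).isUnit

lemma PMat_mulVec_vechM_one {T : ℕ} (hT : 2 ≤ T) : PMat T *ᵥ vechM 1 = wVec T := by
  ext r
  have h : vechM (1 : Matrix (Fin T) (Fin T) ℝ) (vechOne hT) = 0 :=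
    one_apply_ne fun h => by simp [vechOne] at h
  simp [PMat_mulVec hT, wVec, h]

lemma vechM_tri_vechOne {T : ℕ} (hT : 2 ≤ T) :
    vechM (tri T 1 2 (-1)) (vechOne hT) = -1 := by
  simp [vechM, vechOne, tri]

lemma PMat_mulVec_vechM_tri {T : ℕ} (hT : 2 ≤ T) : PMat T *ᵥ vechM (tri T 1 2 (-1)) = 0 := by
  ext r
  simp [PMat_mulVec hT, vechM_tri_vechOne, gVec]

lemma PMat_mulVec_vechM_single {T : ℕ} (hT : 2 ≤ T) :
    PMat T *ᵥ vechM (single (⟨0, by omega⟩ : Fin T) (⟨0, by omega⟩ : Fin T) 1) = 0 := by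
  ext r
  have h : ¬ ((⟨0, by omega⟩ : Fin T) = r.val.val.2 ∧ (⟨0, by omega⟩ : Fin T) = r.val.val.1) := by
    rintro ⟨h1, h2⟩
    exact r.2.1 ⟨by rw [← h2], by rw [← h1]⟩
  simp [PMat_mulVec hT, vechM, vechOne, h]

lemma PMat_transpose_mulVec {T : ℕ} (hT : 2 ≤ T) {v : VechIdx T → ℝ} (h0 : v (vechZero hT) = 0)
    (h1 : vechM (tri T 1 2 (-1)) ⬝ᵥ v = 0) :
    (PMat T)ᵀ *ᵥ (fun r : RIdx T => v r.val) = v := by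
  ext c
  rw [mulVec_transpose]
  simp only [vecMul, dotProduct]
  by_cases hc0 : (c.val.1 : ℕ) = 0 ∧ (c.val.2 : ℕ) = 0
  · simp [eq_vechZero hT hc0, PMat_vechZero, h0]
  by_cases hc1 : (c.val.1 : ℕ) = 0 ∧ (c.val.2 : ℕ) = 1
  · rw [dotProduct, sum_vechIdx hT, h0, vechM_tri_vechOne] at h1
    simp only [eq_vechOne hT hc1, PMat_vechOne, gVec]
    simp only [mul_comm (v _)]
    linarith
  · lift c to RIdx T using ⟨hc0, hc1⟩
    simp [PMat_val]

lemma sum_sub_sq (t : ℝ) (n : ℕ) :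
    ∑ i : Fin n, (t - (i : ℕ)) * (t - (i : ℕ)) =
      n * t ^ 2 - n * (n - 1) * t + n * (n - 1) * (2 * n - 1) / 6 := by
  induction n with
  | zero => simp
  | succ n ih =>
    rw [Fin.sum_univ_castSucc]
    simp only [Fin.val_castSucc, Fin.val_last, ih]
    push_cast
    ring

lemma sum_sub_max_sq (t : ℝ) (n : ℕ) :
    ∑ i : Fin n, ∑ j : Fin n, (t - ((max (i : ℕ) j : ℕ) : ℝ)) * (t - ((max (i : ℕ) j : ℕ) : ℝ)) =
      n ^ 2 * t ^ 2 - 2 * t * (n * (n - 1) * (4 * n + 1) / 6)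
        + n * (n - 1) * (3 * n ^ 2 - n - 1) / 6 := by
  induction n with
  | zero => simp
  | succ n ih =>
    have h : ∀ i : Fin n, max (i : ℕ) n = n := fun i => max_eq_right i.isLt.le
    have h' : ∀ i : Fin n, max n (i : ℕ) = n := fun i => max_eq_left i.isLt.le
    simp only [Fin.sum_univ_castSucc, Fin.val_castSucc, Fin.val_last, Finset.sum_add_distrib, ih,
      h, h', max_self, Finset.sum_const, Finset.card_univ, Fintype.card_fin, nsmul_eq_mul]
    push_cast
    ring

lemma trace_maxMat (T : ℕ) : (maxMat T).trace = T * (T + 1) / 2 := by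
  have h : ∀ (t : ℝ) (n : ℕ), ∑ i : Fin n, (t - (i : ℕ)) = n * t - n * (n - 1) / 2 := by
    intro t n
    induction n with
    | zero => simp
    | succ n ih =>
      rw [Fin.sum_univ_castSucc]
      simp only [Fin.val_castSucc, Fin.val_last, ih]
      push_cast
      ring
  simp only [trace, diag, maxMat, of_apply, max_self, h]
  ring

lemma trace_maxMat_mul_self (T : ℕ) :
    (maxMat T * maxMat T).trace = T * (T + 1) * (T ^ 2 + T + 1) / 6 := by
  have h : (maxMat T * maxMat T).trace = ∑ i : Fin T, ∑ j : Fin T,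
      ((T : ℝ) - ((max (i : ℕ) j : ℕ) : ℝ)) * ((T : ℝ) - ((max (i : ℕ) j : ℕ) : ℝ)) := by
    simp only [trace, diag, mul_apply, maxMat, of_apply, max_comm]
  rw [h, sum_sub_max_sq]
  ring

lemma maxMat_mul_self_zero {T : ℕ} (z : Fin T) (hz : (z : ℕ) = 0) :
    (maxMat T * maxMat T) z z = T * (T + 1) * (2 * T + 1) / 6 := by
  have h : (maxMat T * maxMat T) z z =
      ∑ i : Fin T, ((T : ℝ) - (i : ℕ)) * ((T : ℝ) - (i : ℕ)) := by
    simp [mul_apply, maxMat, hz]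
  rw [h, sum_sub_sq]
  ring

/-- R_T is invertible and w_T′ R_T⁻¹ w_T = (2T−1)(T+1)T(T−1)/72. -/
theorem stmt_5 (T : ℕ) (hT : 2 ≤ T) :
    IsUnit (RMat T) ∧
      wVec T ⬝ᵥ ((RMat T)⁻¹ *ᵥ wVec T) =
        (2 * (T : ℝ) - 1) * ((T : ℝ) + 1) * (T : ℝ) * ((T : ℝ) - 1) / 72 := by
  refine ⟨RMat_isUnit T, ?_⟩
  set z : Fin T := ⟨0, by omega⟩ with hz
  set G := tri T 1 2 (-1) with hG
  set K := maxMat T with hK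
  have hGK : G * K = 1 := tri_mul_maxMat T
  have hKG : K * G = 1 := maxMat_mul_tri T
  have hKz : K z z = T := by simp [hK, maxMat, hz]
  set a : ℝ := ((T : ℝ) + 1) / 3 with ha
  set b : ℝ := ((T : ℝ) + 1) / 6 with hb
  set X : Matrix (Fin T) (Fin T) ℝ := 1 - a • single z z 1 - b • G with hX
  set S := K * X * K with hS
  have hXt : Xᵀ = X := by
    simp only [hX, transpose_sub, transpose_smul, transpose_one, transpose_single, hG,
      tri_transpose]
  have hKt : Kᵀ = K := maxMat_transpose T
  have hSt : Sᵀ = S := by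
    rw [hS, transpose_mul, transpose_mul, hXt, hKt, Matrix.mul_assoc]
  have hGSG : G * S * G = X := by
    calc G * S * G = (G * K) * X * (K * G) := by simp only [hS, Matrix.mul_assoc]
      _ = X := by rw [hGK, hKG, Matrix.one_mul, Matrix.mul_one]
  have hSeq : S = K * K - a • (K * single z z 1 * K) - b • K := by
    simp only [hS, hX, Matrix.mul_sub, Matrix.sub_mul, Matrix.mul_one, Matrix.mul_smul,
      Matrix.smul_mul, hKG, Matrix.one_mul]
  have hsz : S z z = 0 := by
    have : (K * single z z (1 : ℝ) * K) z z = T * T := by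
      simp [mul_apply, single_apply, ite_and, hKz]
    simp only [hSeq, Matrix.sub_apply, Matrix.smul_apply, smul_eq_mul, this, hKz, ha, hb]
    rw [hK, maxMat_mul_self_zero z rfl]
    ring
  have htrGS : (G * S).trace = 0 := by
    have h : G * S = X * K := by
      rw [hS, ← Matrix.mul_assoc, ← Matrix.mul_assoc, hGK, Matrix.one_mul]
    have h' : (single z z (1 : ℝ) * K).trace = T := by
      rw [trace_single_mul]; simp [hKz]
    rw [h, hX]
    simp only [Matrix.sub_mul, Matrix.one_mul, Matrix.smul_mul, hGK, trace_sub, trace_smul, h',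
      trace_one, Fintype.card_fin, smul_eq_mul, ha, hb]
    rw [hK, trace_maxMat]
    ring
  have htrS : S.trace = (2 * (T : ℝ) - 1) * ((T : ℝ) + 1) * (T : ℝ) * ((T : ℝ) - 1) / 36 := by
    have h : (K * single z z 1 * K).trace = (K * K) z z := by
      rw [Matrix.mul_assoc, trace_mul_comm, Matrix.mul_assoc, trace_single_mul]; simp
    simp only [hSeq, trace_sub, trace_smul, smul_eq_mul, h, ha, hb]
    rw [hK, maxMat_mul_self_zero z rfl, trace_maxMat, trace_maxMat_mul_self]
    ring
  set v : VechIdx T → ℝ := (1 / 2 : ℝ) • ((dup T)ᵀ *ᵥ vecM S) with hv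
  have hv0 : v (vechZero hT) = 0 := by
    have h : ∀ p : Fin T × Fin T, dup T p (vechZero hT) * vecM S p = 0 := by
      rintro ⟨i, j⟩
      by_cases h : i = z ∧ j = z
      · rw [h.1, h.2]; simp [vecM, hsz]
      · simp [dup, vechZero, ← hz, h]
    simp [hv, mulVec, dotProduct, h]
  have hv1 : vechM (tri T 1 2 (-1)) ⬝ᵥ v = 0 := by
    rw [hv, dotProduct_smul, vechM_dotProduct (tri_transpose _ _ _ _), ← hG, htrGS, smul_zero]
  have hP := PMat_transpose_mulVec hT hv0 hv1
  have hRy : RMat T *ᵥ (fun r : RIdx T => v r.val) = wVec T := by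
    have hlin : vechM X = vechM 1 - a • vechM (single z z 1) - b • vechM G := rfl
    rw [RMat, ← mulVec_mulVec, hP, ← mulVec_mulVec, hv, MMat_mulVec hSt, ← hG, hGSG, hlin,
      mulVec_sub, mulVec_sub, mulVec_smul, mulVec_smul, PMat_mulVec_vechM_one hT,
      PMat_mulVec_vechM_tri hT, PMat_mulVec_vechM_single hT]
    simp
  have hinv : (RMat T)⁻¹ *ᵥ wVec T = fun r : RIdx T => v r.val := by
    rw [← hRy, mulVec_mulVec,
      nonsing_inv_mul _ ((isUnit_iff_isUnit_det _).mp (RMat_isUnit T)), one_mulVec]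
  rw [hinv, ← PMat_mulVec_vechM_one hT, ← vecMul_transpose, ← dotProduct_mulVec, hP, hv,
    dotProduct_smul, vechM_dotProduct transpose_one, Matrix.one_mul, htrS, smul_eq_mul]
  ring
end
end

section
/- Let T ≥ 2, let G_T = Δ_T(1,2,-1), H_T = Δ_T(0,-2,1) and A_T = Δ_T(−(T−1)/2, −(T−2)/3, (T+1)/6). Then tr(G_T⁻¹·A_T·G_T⁻¹·H_T) = 0. -/
open Matrix
open scoped Matrix Kronecker

noncomputable section

/-- A row vector vanishing at index `n`, multiplied by the `j`-th column of `tri n 1 2 (-1)`. -/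
theorem sum_mul_tri (n : ℕ) (f : ℕ → ℝ) (hf : f n = 0) (j : Fin n) :
    ∑ k : Fin n, f k * tri n 1 2 (-1) k j =
      2 * f j - f (j + 1) - f ((j : ℕ) - 1) := by
  have key : ∀ k : ℕ, f k * (if k = (j : ℕ) then (if k = 0 then (1 : ℝ) else 2)
      else if k + 1 = (j : ℕ) ∨ (j : ℕ) + 1 = k then -1 else 0) =
      (if (j : ℕ) = k then 2 * f k else 0) - (if (j : ℕ) + 1 = k then f k else 0) -
        (if (j : ℕ) - 1 = k then f k else 0) := by
    intro k
    split_ifs <;> first | (exfalso; omega) | ring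
  simp only [tri, Matrix.of_apply]
  rw [Fin.sum_univ_eq_sum_range (fun k => f k * (if k = (j : ℕ) then (if k = 0 then (1 : ℝ) else 2)
      else if k + 1 = (j : ℕ) ∨ (j : ℕ) + 1 = k then -1 else 0)) n, Finset.sum_congr rfl
      fun k _ => key k]
  simp only [Finset.sum_sub_distrib, Finset.sum_ite_eq, Finset.mem_range]
  have hj := j.isLt
  rw [if_pos hj, if_pos (by omega : (j : ℕ) - 1 < n)]
  split_ifs with h
  · rfl
  · rw [show (j : ℕ) + 1 = n by omega, hf]

/-- The inverse of `tri n 1 2 (-1)`. -/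
def triInv (n : ℕ) : Matrix (Fin n) (Fin n) ℝ :=
  Matrix.of fun i j => (n : ℝ) - ((max (i : ℕ) j : ℕ) : ℝ)

theorem triInv_mul_tri (n : ℕ) : triInv n * tri n 1 2 (-1) = 1 := by
  ext i j
  rw [Matrix.mul_apply]
  have h := sum_mul_tri n (fun k => (n : ℝ) - ((max (i : ℕ) k : ℕ) : ℝ))
    (by simp) j
  simp only [triInv, Matrix.of_apply]
  rw [h, Matrix.one_apply]
  split_ifs with hij
  · subst hij
    rw [max_self, max_eq_right (by omega), max_eq_left (by omega)]
    push_cast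
    ring
  · rcases Nat.lt_or_gt_of_ne (Fin.val_ne_of_ne hij) with hlt | hlt
    · rw [max_eq_right (by omega), max_eq_right (by omega), max_eq_right (by omega)]
      rw [Nat.cast_sub (by omega)]
      push_cast
      ring
    · rw [max_eq_left (by omega), max_eq_left (by omega), max_eq_left (by omega)]
      ring

theorem tri_inv (n : ℕ) : (tri n 1 2 (-1))⁻¹ = triInv n :=
  Matrix.inv_eq_left_inv (triInv_mul_tri n)

theorem trace_triInv (n : ℕ) : (triInv n).trace = (n : ℝ) * (n + 1) / 2 := by
  have h : ∀ m : ℕ, ∑ k ∈ Finset.range m, ((n : ℝ) - k) = n * m - m * (m - 1) / 2 := by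
    intro m
    induction m with
    | zero => simp
    | succ m ih => rw [Finset.sum_range_succ, ih]; push_cast; ring
  simp only [Matrix.trace, Matrix.diag, triInv, Matrix.of_apply, max_self]
  rw [Fin.sum_univ_eq_sum_range (fun k => (n : ℝ) - (k : ℝ)), h]
  ring

theorem triInv_mul_self_zero (n : ℕ) :
    (triInv (n + 1) * triInv (n + 1)) 0 0 =
      ((n : ℝ) + 1) * (n + 2) * (2 * n + 3) / 6 := by
  have h : ∀ m : ℕ, ∑ k ∈ Finset.range m, ((n : ℝ) + 1 - k) * ((n : ℝ) + 1 - k) =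
      (n + 1) ^ 2 * m - (n + 1) * (m * (m - 1)) + (m - 1) * m * (2 * m - 1) / 6 := by
    intro m
    induction m with
    | zero => simp
    | succ m ih => rw [Finset.sum_range_succ, ih]; push_cast; ring
  simp only [Matrix.mul_apply, triInv, Matrix.of_apply, Fin.val_zero, Nat.zero_max, Nat.max_zero,
    Nat.cast_add, Nat.cast_one]
  rw [Fin.sum_univ_eq_sum_range (fun k => ((n : ℝ) + 1 - k) * ((n : ℝ) + 1 - k)), h]
  push_cast
  ring

theorem tri_eq_linear_combination (n : ℕ) (x y z : ℝ) :
    tri (n + 1) (x + y + z) (2 * x + y) (-x) =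
      x • tri (n + 1) 1 2 (-1) + y • (1 : Matrix (Fin (n + 1)) (Fin (n + 1)) ℝ) +
        z • Matrix.single 0 0 1 := by
  ext i j
  simp only [tri, Matrix.add_apply, Matrix.smul_apply, Matrix.of_apply, Matrix.one_apply,
    Matrix.single_apply, Fin.ext_iff, Fin.val_zero, smul_eq_mul]
  split_ifs <;> first | (exfalso; omega) | ring

/-- with G_T = Δ_T(1,2,-1), H_T = Δ_T(0,-2,1) and
A_T = Δ_T(−(T−1)/2, −(T−2)/3, (T+1)/6), tr(G_T⁻¹ A_T G_T⁻¹ H_T) = 0. -/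
theorem stmt_7 (T : ℕ) (hT : 2 ≤ T) :
    Matrix.trace
        ((tri T 1 2 (-1))⁻¹ *
          tri T (-(((T : ℝ) - 1) / 2)) (-(((T : ℝ) - 2) / 3)) (((T : ℝ) + 1) / 6) *
          (tri T 1 2 (-1))⁻¹ * tri T 0 (-2) 1) = 0 := by
  obtain ⟨n, rfl⟩ : ∃ n, T = n + 1 := ⟨T - 1, by omega⟩
  have hH := tri_eq_linear_combination n (-1) 0 1
  have hA := tri_eq_linear_combination n (-((n : ℝ) + 2) / 6) 1 (-((n : ℝ) + 2) / 3)
  have hKG := triInv_mul_tri (n + 1)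
  rw [tri_inv]
  have eH : tri (n + 1) 0 (-2) 1 = Matrix.single 0 0 1 - tri (n + 1) 1 2 (-1) := by
    convert hH using 1
    · norm_num
    · simp only [neg_smul, one_smul, zero_smul]
      abel
  have eA : tri (n + 1) (-((((n + 1 : ℕ) : ℝ) - 1) / 2)) (-((((n + 1 : ℕ) : ℝ) - 2) / 3))
      ((((n + 1 : ℕ) : ℝ) + 1) / 6) = (-((n : ℝ) + 2) / 6) • tri (n + 1) 1 2 (-1) +
        (1 : ℝ) • (1 : Matrix (Fin (n + 1)) (Fin (n + 1)) ℝ) +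
        (-((n : ℝ) + 2) / 3) • Matrix.single 0 0 1 := by
    refine Eq.trans ?_ hA
    congr 1 <;> push_cast <;> ring
  rw [eA, eH]
  generalize tri (n + 1) 1 2 (-1) = G at *
  have h00 : triInv (n + 1) 0 0 = (n : ℝ) + 1 := by simp [triInv]
  have htr := trace_triInv (n + 1)
  have hsq := triInv_mul_self_zero n
  generalize triInv (n + 1) = K at *
  have hE (M : Matrix (Fin (n + 1)) (Fin (n + 1)) ℝ) :
      (M * Matrix.single 0 0 1).trace = M 0 0 := by
    simp [Matrix.trace_mul_single]
  have hKEK : (K * Matrix.single 0 0 (1 : ℝ) * K : Matrix (Fin (n + 1)) (Fin (n + 1)) ℝ) 0 0 =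
      ((n : ℝ) + 1) * (n + 1) := by
    rw [← hE (K * Matrix.single 0 0 1 * K), Matrix.trace_mul_comm, ← mul_assoc, ← mul_assoc,
      Matrix.single_mul_mul_single, Matrix.trace_mul_comm]
    simp only [Matrix.trace_mul_single, h00, one_mul, mul_one, MulOpposite.smul_eq_mul_unop,
      MulOpposite.unop_op]
  rw [mul_sub, Matrix.trace_sub, hE, mul_assoc _ K G, hKG, mul_one]
  simp only [mul_add, add_mul, Matrix.mul_smul, Matrix.smul_mul, hKG, one_mul, mul_one,
    Matrix.trace_add, Matrix.trace_smul, Matrix.trace_one, Matrix.add_apply, Matrix.smul_apply,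
    hE, h00, htr, hsq, hKEK, smul_eq_mul, Fintype.card_fin]
  push_cast
  ring
end
end
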